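/- Let u ∈ S_n, let x̃ ∈ N satisfy x̃ u⁻¹ ∈ G_0, and let x_u ∈ N^u. Then there exists a unique n_- ∈ N_-(u) such that x̃ n_- admits a Gaussian decomposition and [x̃ n_-]_+ ∈ x_u N(u). Moreover, if x̃ and x_u are totally nonnegative, then [x̃ n_-]_+ is totally nonnegative. -/

import Mathlib

open scoped Classical

namespace BruhatTNN

abbrev Mat (n : ℕ) := Matrix (Fin n) (Fin n) ℝ

/-- `x` is upper unitriangular. -/
def upperUni {n : ℕ} (x : Mat n) : Prop :=
  (∀ i, x i i = 1) ∧ ∀ i j : Fin n, j < i → x i j = 0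

/-- `x` is lower unitriangular. -/
def lowerUni {n : ℕ} (x : Mat n) : Prop :=
  (∀ i, x i i = 1) ∧ ∀ i j : Fin n, i < j → x i j = 0

/-- `x` is invertible upper triangular (`x ∈ B`). -/
def upperTriInv {n : ℕ} (x : Mat n) : Prop :=
  IsUnit x.det ∧ ∀ i j : Fin n, j < i → x i j = 0

/-- `x` is invertible lower triangular (`x ∈ B_-`). -/
def lowerTriInv {n : ℕ} (x : Mat n) : Prop :=
  IsUnit x.det ∧ ∀ i j : Fin n, i < j → x i j = 0

/-- `x` is invertible diagonal (`x ∈ H`). -/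
def diagInv {n : ℕ} (x : Mat n) : Prop :=
  IsUnit x.det ∧ ∀ i j : Fin n, i ≠ j → x i j = 0

/-- `x` admits a Gaussian decomposition (`x ∈ G_0`). -/
def hasGauss {n : ℕ} (x : Mat n) : Prop :=
  ∃ a d b : Mat n, lowerUni a ∧ diagInv d ∧ upperUni b ∧ x = a * d * b

/-- The factor `[x]_-` of the Gaussian decomposition (junk value `1` if none exists). -/
noncomputable def gaussMinus {n : ℕ} (x : Mat n) : Mat n :=
  if h : hasGauss x then h.choose else 1

/-- The factor `[x]_0` of the Gaussian decomposition (junk value `1` if none exists). -/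
noncomputable def gaussDiag {n : ℕ} (x : Mat n) : Mat n :=
  if h : hasGauss x then h.choose_spec.choose else 1

/-- The factor `[x]_+` of the Gaussian decomposition (junk value `1` if none exists). -/
noncomputable def gaussPlus {n : ℕ} (x : Mat n) : Mat n :=
  if h : hasGauss x then h.choose_spec.choose_spec.choose else 1

/-- The permutation matrix of `w`, with entry `1` in position `(w j, j)`. -/
def permMat {n : ℕ} (w : Equiv.Perm (Fin n)) : Mat n :=
  Matrix.of fun i j => if i = w j then (1 : ℝ) else 0

/-- The minor of `x` with row set `I` and column set `J` (taken in increasing order). -/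
def minorOf {n : ℕ} (x : Mat n) (k : ℕ) (I J : Finset (Fin n))
    (hI : I.card = k) (hJ : J.card = k) : ℝ :=
  Matrix.det (Matrix.of fun a b : Fin k => x (I.orderEmbOfFin hI a) (J.orderEmbOfFin hJ b))

/-- `x` is totally nonnegative: all its minors are nonnegative. -/
def totNonneg {n : ℕ} (x : Mat n) : Prop :=
  ∀ (k : ℕ) (I J : Finset (Fin n)) (hI : I.card = k) (hJ : J.card = k),
    0 ≤ minorOf x k I J hI hJ

/-- The Bruhat order on the symmetric group. -/
def bruhatLE {n : ℕ} (u v : Equiv.Perm (Fin n)) : Prop :=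
  ∀ i j : Fin n,
    (Finset.univ.filter fun k : Fin n => k ≤ i ∧ j ≤ u k).card ≤
    (Finset.univ.filter fun k : Fin n => k ≤ i ∧ j ≤ v k).card

/-- The double coset `B_- w B_-`. -/
def doubleCosetBm {n : ℕ} (w : Equiv.Perm (Fin n)) : Set (Mat n) :=
  {x | ∃ b₁ b₂ : Mat n, lowerTriInv b₁ ∧ lowerTriInv b₂ ∧ x = b₁ * permMat w * b₂}

/-- `N^w = B_- w B_- ∩ N`. -/
def Ncell {n : ℕ} (w : Equiv.Perm (Fin n)) : Set (Mat n) :=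
  {x | upperUni x ∧ x ∈ doubleCosetBm w}

/-- `N_-(w) = w⁻¹ N w ∩ N_-`. -/
def Nminus {n : ℕ} (w : Equiv.Perm (Fin n)) : Set (Mat n) :=
  {x | lowerUni x ∧ ∃ y : Mat n, upperUni y ∧ x = permMat w⁻¹ * y * permMat w}

/-- `N(w) = w⁻¹ N w ∩ N`. -/
def Ngrp {n : ℕ} (w : Equiv.Perm (Fin n)) : Set (Mat n) :=
  {x | upperUni x ∧ ∃ y : Mat n, upperUni y ∧ x = permMat w⁻¹ * y * permMat w}

/-- The totally positive cell `Y°_w = Y ∩ B_- w B_-`. -/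
def Ycirc {n : ℕ} (w : Equiv.Perm (Fin n)) : Set (Mat n) :=
  {x | upperUni x ∧ totNonneg x ∧ x ∈ doubleCosetBm w}

/-- `Y_{≥ u} = ⋃_{v ≥ u} Y°_v`. -/
def Yge {n : ℕ} (u : Equiv.Perm (Fin n)) : Set (Mat n) :=
  {x | ∃ v, bruhatLE u v ∧ x ∈ Ycirc v}

/-- `A = u⁻¹ [x u⁻¹]_+ u`. -/
noncomputable def Amat {n : ℕ} (u : Equiv.Perm (Fin n)) (x : Mat n) : Mat n :=
  permMat u⁻¹ * gaussPlus (x * permMat u⁻¹) * permMat u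

/-- The projection `π_u(x) = [u [u⁻¹ [x u⁻¹]_+ u]_-]_+`. -/
noncomputable def piMap {n : ℕ} (u : Equiv.Perm (Fin n)) (x : Mat n) : Mat n :=
  gaussPlus (permMat u * gaussMinus (Amat u x))

/-- `str(M)`: the sum of the matrix entries immediately above the main diagonal. -/
def strAbove {n : ℕ} (M : Mat n) : ℝ :=
  ∑ p : Fin n × Fin n, if (p.1 : ℕ) + 1 = (p.2 : ℕ) then M p.1 p.2 else 0

/-- The number of inversions (the length) of a permutation. -/
def invNum {n : ℕ} (w : Equiv.Perm (Fin n)) : ℕ :=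
  (Finset.univ.filter fun p : Fin n × Fin n => p.1 < p.2 ∧ w p.2 < w p.1).card

/-- All minors of a rectangular matrix are nonnegative. -/
def IsTN {m n : ℕ} (A : Matrix (Fin m) (Fin n) ℝ) : Prop :=
  ∀ (k : ℕ) (f : Fin k → Fin m) (g : Fin k → Fin n), StrictMono f → StrictMono g →
    0 ≤ (A.submatrix f g).det

/-- All minors that do not vanish identically on upper unitriangular matrices are positive. -/
def IsUpperTP {n : ℕ} (A : Mat n) : Prop :=
  ∀ (k : ℕ) (f g : Fin k → Fin n), StrictMono f → StrictMono g → (∀ i, f i ≤ g i) →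
    0 < (A.submatrix f g).det

theorem totNonneg_iff_isTN {n : ℕ} {x : Mat n} : totNonneg x ↔ IsTN x := by
  constructor
  · intro h k f g hf hg
    have hI : (Finset.univ.map ⟨f, hf.injective⟩).card = k := by simp
    have hJ : (Finset.univ.map ⟨g, hg.injective⟩).card = k := by simp
    have h1 := h k _ _ hI hJ
    have e1 : f = _ := Finset.orderEmbOfFin_unique hI (f := f) (by simp) hf
    have e2 : g = _ := Finset.orderEmbOfFin_unique hJ (f := g) (by simp) hg
    rw [e1, e2]
    exact h1
  · intro h k I J hI hJ
    exact h k _ _ (I.orderEmbOfFin hI).strictMono (J.orderEmbOfFin hJ).strictMono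

theorem IsTN.submatrix {m n m' n' : ℕ} {A : Matrix (Fin m) (Fin n) ℝ} (hA : IsTN A)
    {f : Fin m' → Fin m} {g : Fin n' → Fin n} (hf : StrictMono f) (hg : StrictMono g) :
    IsTN (A.submatrix f g) := fun k f' g' hf' hg' =>
  hA k (f ∘ f') (g ∘ g') (hf.comp hf') (hg.comp hg')

theorem IsTN.nonneg {m n : ℕ} {A : Matrix (Fin m) (Fin n) ℝ} (hA : IsTN A) (i : Fin m)
    (j : Fin n) : 0 ≤ A i j := by
  have := hA 1 (fun _ => i) (fun _ => j) (Subsingleton.strictMono _) (Subsingleton.strictMono _)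
  simpa using this

theorem IsTN.mul_le {m n : ℕ} {A : Matrix (Fin m) (Fin n) ℝ} (hA : IsTN A) {i i' : Fin m}
    {j j' : Fin n} (hi : i < i') (hj : j < j') : A i j' * A i' j ≤ A i j * A i' j' := by
  have := hA 2 ![i, i'] ![j, j'] (by simpa [Fin.strictMono_iff_lt_succ] using hi)
    (by simpa [Fin.strictMono_iff_lt_succ] using hj)
  rw [Matrix.det_fin_two] at this
  simp at this
  linarith

/-! ### The Cauchy–Binet formula -/

theorem det_mul_eq_sum {k n : ℕ} (A : Matrix (Fin k) (Fin n) ℝ) (B : Matrix (Fin n) (Fin k) ℝ) :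
    (A * B).det = ∑ p : Fin k → Fin n, (A.submatrix id p).det * ∏ i, B (p i) i := by
  simp only [Matrix.det_apply', Matrix.mul_apply, Finset.prod_univ_sum, Finset.mul_sum,
    Fintype.piFinset_univ, Finset.sum_mul, Matrix.submatrix_apply, id]
  rw [Finset.sum_comm]
  refine Finset.sum_congr rfl fun p _ => Finset.sum_congr rfl fun σ _ => ?_
  rw [Finset.prod_mul_distrib]
  ring

theorem factorial_mul_det_mul {k n : ℕ} (A : Matrix (Fin k) (Fin n) ℝ)
    (B : Matrix (Fin n) (Fin k) ℝ) :
    (k.factorial : ℝ) * (A * B).det =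
      ∑ p : Fin k → Fin n, (A.submatrix id p).det * (B.submatrix p id).det := by
  have h : ∀ σ : Equiv.Perm (Fin k), (A * B).det =
      ∑ p : Fin k → Fin n, (A.submatrix id p).det *
        ((Equiv.Perm.sign σ : ℤ) * ∏ i, B (p (σ i)) i) := by
    intro σ
    rw [det_mul_eq_sum, ← (Equiv.arrowCongr σ (Equiv.refl (Fin n))).symm.sum_comp]
    refine Finset.sum_congr rfl fun p _ => ?_
    have e : A.submatrix id ((Equiv.arrowCongr σ (Equiv.refl (Fin n))).symm p)
        = (A.submatrix id p).submatrix id σ := by ext; simp [Equiv.arrowCongr]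
    rw [e, Matrix.det_permute']
    simp [Equiv.arrowCongr]
    ring
  have h2 : ∑ _σ : Equiv.Perm (Fin k), (A * B).det = (k.factorial : ℝ) * (A * B).det := by
    simp [Fintype.card_perm]
  rw [← h2, Finset.sum_congr rfl fun σ _ => h σ, Finset.sum_comm]
  refine Finset.sum_congr rfl fun p _ => ?_
  rw [← Finset.mul_sum, Matrix.det_apply' (B.submatrix p id)]
  rfl

/-- The product of complementary minors in the Cauchy–Binet formula is invariant under
reordering the index sequence. -/
theorem minor_mul_minor_comp_perm {k n : ℕ} (A : Matrix (Fin k) (Fin n) ℝ)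
    (B : Matrix (Fin n) (Fin k) ℝ) (p : Fin k → Fin n) (σ : Equiv.Perm (Fin k)) :
    (A.submatrix id (p ∘ σ)).det * (B.submatrix (p ∘ σ) id).det =
      (A.submatrix id p).det * (B.submatrix p id).det := by
  have e1 : A.submatrix id (p ∘ σ) = (A.submatrix id p).submatrix id σ := rfl
  have e2 : B.submatrix (p ∘ σ) id = (B.submatrix p id).submatrix σ id := rfl
  rw [e1, e2, Matrix.det_permute', Matrix.det_permute]
  have : ((Equiv.Perm.sign σ : ℤ) : ℝ) * ((Equiv.Perm.sign σ : ℤ) : ℝ) = 1 := by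
    rcases Int.units_eq_one_or (Equiv.Perm.sign σ) with h | h <;> simp [h]
  linear_combination (A.submatrix id p).det * (B.submatrix p id).det * this

theorem exists_perm_strictMono {k n : ℕ} {p : Fin k → Fin n} (hp : Function.Injective p) :
    ∃ σ : Equiv.Perm (Fin k), StrictMono (p ∘ σ) :=
  ⟨Tuple.sort p, (Tuple.monotone_sort p).strictMono_of_injective
    (hp.comp (Tuple.sort p).injective)⟩

theorem minor_mul_minor_nonneg {k n : ℕ} {A : Matrix (Fin k) (Fin n) ℝ}
    {B : Matrix (Fin n) (Fin k) ℝ} (hA : IsTN A) (hB : IsTN B) (p : Fin k → Fin n) :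
    0 ≤ (A.submatrix id p).det * (B.submatrix p id).det := by
  by_cases hp : Function.Injective p
  · obtain ⟨σ, hσ⟩ := exists_perm_strictMono hp
    rw [← minor_mul_minor_comp_perm A B p σ]
    exact mul_nonneg (hA _ _ _ strictMono_id hσ) (hB _ _ _ hσ strictMono_id)
  · simp only [Function.Injective, not_forall] at hp
    obtain ⟨i, j, hij, hne⟩ := hp
    rw [Matrix.det_zero_of_column_eq hne (M := A.submatrix id p) (by simp [hij])]
    simp

theorem minor_mul_minor_le_det_mul {k n : ℕ} {A : Matrix (Fin k) (Fin n) ℝ}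
    {B : Matrix (Fin n) (Fin k) ℝ} (hA : IsTN A) (hB : IsTN B) {h : Fin k → Fin n}
    (hh : Function.Injective h) :
    (A.submatrix id h).det * (B.submatrix h id).det ≤ (A * B).det := by
  have hk : (0 : ℝ) < k.factorial := by exact_mod_cast k.factorial_pos
  refine le_of_mul_le_mul_left ?_ hk
  rw [factorial_mul_det_mul]
  have inj : Function.Injective fun σ : Equiv.Perm (Fin k) => h ∘ σ := by
    intro σ τ hστ
    ext i
    exact congrArg Fin.val (hh (congrFun hστ i))
  calc (k.factorial : ℝ) * ((A.submatrix id h).det * (B.submatrix h id).det)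
      = ∑ σ : Equiv.Perm (Fin k),
          (A.submatrix id (h ∘ σ)).det * (B.submatrix (h ∘ σ) id).det := by
        simp only [minor_mul_minor_comp_perm]
        simp [Fintype.card_perm]
    _ = ∑ p ∈ Finset.univ.map ⟨_, inj⟩, (A.submatrix id p).det * (B.submatrix p id).det := by
        rw [Finset.sum_map]
        rfl
    _ ≤ _ := Finset.sum_le_sum_of_subset_of_nonneg (Finset.subset_univ _)
        fun p _ _ => minor_mul_minor_nonneg hA hB p

theorem IsTN.mul {l m n : ℕ} {A : Matrix (Fin l) (Fin m) ℝ} {B : Matrix (Fin m) (Fin n) ℝ}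
    (hA : IsTN A) (hB : IsTN B) : IsTN (A * B) := by
  intro k f g hf hg
  have hk : (0 : ℝ) < k.factorial := by exact_mod_cast k.factorial_pos
  refine nonneg_of_mul_nonneg_right ?_ hk
  rw [Matrix.submatrix_mul A B f id g Function.bijective_id, factorial_mul_det_mul]
  exact Finset.sum_nonneg fun p _ =>
    minor_mul_minor_nonneg (hA.submatrix hf strictMono_id) (hB.submatrix strictMono_id hg) p

theorem IsTN.minor_mul_minor_le {l m n k : ℕ} {A : Matrix (Fin l) (Fin m) ℝ}
    {B : Matrix (Fin m) (Fin n) ℝ} (hA : IsTN A) (hB : IsTN B) {f : Fin k → Fin l}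
    {h : Fin k → Fin m} {g : Fin k → Fin n} (hf : StrictMono f) (hh : StrictMono h)
    (hg : StrictMono g) :
    (A.submatrix f h).det * (B.submatrix h g).det ≤ ((A * B).submatrix f g).det := by
  rw [Matrix.submatrix_mul A B f id g Function.bijective_id]
  exact minor_mul_minor_le_det_mul (hA.submatrix hf strictMono_id)
    (hB.submatrix strictMono_id hg) hh.injective

/-! ### Minors of upper unitriangular matrices -/

theorem upperUni.det_principal {n k : ℕ} {x : Mat n} (hx : upperUni x) {f : Fin k → Fin n}
    (hf : StrictMono f) : (x.submatrix f f).det = 1 := by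
  rw [Matrix.det_of_isUpperTriangular]
  · simp [hx.1]
  · intro i j hij
    exact hx.2 _ _ (hf hij)

theorem det_eq_zero_of_zero_block {k : ℕ} {M : Matrix (Fin k) (Fin k) ℝ} (i₀ : Fin k)
    (h : ∀ i j, i₀ ≤ i → j ≤ i₀ → M i j = 0) : M.det = 0 := by
  rw [Matrix.det_apply]
  refine Finset.sum_eq_zero fun σ _ => ?_
  obtain ⟨j, hj, hσ⟩ : ∃ j, j ≤ i₀ ∧ i₀ ≤ σ j := by
    by_contra! hcon
    have := Finset.card_le_card_of_injOn σ (s := Finset.Iic i₀) (t := Finset.Iio i₀)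
      (fun j hj => by simpa using hcon j (by simpa using hj)) σ.injective.injOn
    simp at this
  have : ∏ i, M (σ i) i = 0 := Finset.prod_eq_zero (Finset.mem_univ j) (h _ _ hσ hj)
  exact (congrArg (Equiv.Perm.sign σ • ·) this).trans (smul_zero _)

theorem upperUni.minor_eq_zero {n k : ℕ} {x : Mat n} (hx : upperUni x) {f g : Fin k → Fin n}
    (hf : StrictMono f) (hg : StrictMono g) {i : Fin k} (hi : g i < f i) :
    (x.submatrix f g).det = 0 :=
  det_eq_zero_of_zero_block i fun _ _ ha hb =>
    hx.2 _ _ (((hg.monotone hb).trans_lt hi).trans_le (hf.monotone ha))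

theorem IsUpperTP.isTN {n : ℕ} {x : Mat n} (h : IsUpperTP x) (hx : upperUni x) : IsTN x := by
  intro k f g hf hg
  by_cases hfg : ∀ i, f i ≤ g i
  · exact (h k f g hf hg hfg).le
  · push Not at hfg
    obtain ⟨i, hi⟩ := hfg
    exact (hx.minor_eq_zero hf hg hi).ge

theorem IsTN.mul_isUpperTP {n : ℕ} {x y : Mat n} (hx : IsTN x) (hxu : upperUni x)
    (hy : IsUpperTP y) (hyu : upperUni y) : IsUpperTP (x * y) := by
  intro k f g hf hg hfg
  have := hx.minor_mul_minor_le (hy.isTN hyu) hf hf hg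
  rw [hxu.det_principal hf, one_mul] at this
  exact (hy k f g hf hg hfg).trans_le this

/-! ### Bidiagonal matrices -/

/-- The matrix with ones on the diagonal and `ε` just above it. -/
def bidiag (n : ℕ) (ε : ℝ) : Mat n :=
  Matrix.of fun i j => if i = j then 1 else if (i : ℕ) + 1 = j then ε else 0

theorem upperUni_bidiag (n : ℕ) (ε : ℝ) : upperUni (bidiag n ε) := by
  refine ⟨fun i => by simp [bidiag], fun i j hij => ?_⟩
  have h1 : i ≠ j := hij.ne'
  have h2 : (i : ℕ) + 1 ≠ j := by have := Fin.lt_def.1 hij; omega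
  simp [bidiag, h1, h2]

theorem bidiag_zero (n : ℕ) : bidiag n 0 = 1 := by
  ext i j
  simp [bidiag, Matrix.one_apply]

theorem det_bidiag_submatrix {n : ℕ} (ε : ℝ) : ∀ (k : ℕ) (f g : Fin k → Fin n),
    StrictMono f → StrictMono g →
    ((bidiag n ε).submatrix f g).det = ∏ i, bidiag n ε (f i) (g i) := by
  intro k
  induction k with
  | zero => simp
  | succ k ih =>
    intro f g hf hg
    have hsub : ((bidiag n ε).submatrix (f ∘ Fin.succ) (g ∘ Fin.succ)).det
        = ∏ i : Fin k, bidiag n ε (f i.succ) (g i.succ) :=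
      ih _ _ (hf.comp Fin.strictMono_succ) (hg.comp Fin.strictMono_succ)
    rw [Fin.prod_univ_succ, ← hsub]
    rcases lt_or_ge (f 0) (g 0) with h | h
    · rw [Matrix.det_succ_row_zero, Fin.sum_univ_succ, Finset.sum_eq_zero]
      · simp [Matrix.submatrix_submatrix]
      · intro j _
        have h1 : g 0 < g j.succ := hg (Fin.succ_pos j)
        have : bidiag n ε (f 0) (g j.succ) = 0 := by
          have h2 : f 0 ≠ g j.succ := (h.trans h1).ne
          have h3 : (f 0 : ℕ) + 1 ≠ g j.succ := by
            have := Fin.lt_def.1 h1; have := Fin.lt_def.1 h; omega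
          simp [bidiag, h2, h3]
        simp [this]
    · rw [Matrix.det_succ_column_zero, Fin.sum_univ_succ, Finset.sum_eq_zero]
      · simp [Matrix.submatrix_submatrix]
      · intro j _
        have h1 : f 0 < f j.succ := hf (Fin.succ_pos j)
        have := (upperUni_bidiag n ε).2 (f j.succ) (g 0) (h.trans_lt h1)
        simp [this]

theorem isTN_bidiag (n : ℕ) {ε : ℝ} (hε : 0 ≤ ε) : IsTN (bidiag n ε) := by
  intro k f g hf hg
  rw [det_bidiag_submatrix ε k f g hf hg]
  refine Finset.prod_nonneg fun i _ => ?_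
  simp only [bidiag, Matrix.of_apply]
  split_ifs <;> simp [hε]

theorem isTN_one (n : ℕ) : IsTN (1 : Mat n) := bidiag_zero n ▸ isTN_bidiag n le_rfl

theorem upperUni_one (n : ℕ) : upperUni (1 : Mat n) := bidiag_zero n ▸ upperUni_bidiag n 0

theorem upperUni.mul {n : ℕ} {x y : Mat n} (hx : upperUni x) (hy : upperUni y) :
    upperUni (x * y) := by
  have h1 : x.BlockTriangular id := fun i j h => hx.2 i j h
  have h2 : y.BlockTriangular id := fun i j h => hy.2 i j h
  refine ⟨fun i => ?_, fun i j h => (h1.mul h2) h⟩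
  rw [Matrix.mul_apply, Finset.sum_eq_single i]
  · simp [hx.1, hy.1]
  · intro j _ hj
    rcases lt_or_gt_of_ne hj with h | h
    · simp [hx.2 i j h]
    · simp [hy.2 j i h]
  · simp

theorem upperUni.pow {n : ℕ} {x : Mat n} (hx : upperUni x) (t : ℕ) : upperUni (x ^ t) := by
  induction t with
  | zero => simpa using upperUni_one n
  | succ t ih => rw [pow_succ]; exact ih.mul hx

theorem IsTN.pow {n : ℕ} {x : Mat n} (hx : IsTN x) (t : ℕ) : IsTN (x ^ t) := by
  induction t with
  | zero => simpa using isTN_one n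
  | succ t ih => rw [pow_succ]; exact ih.mul hx

/-- The `n`-th power of the bidiagonal matrix is totally positive. -/
theorem isUpperTP_bidiag_pow (n : ℕ) {ε : ℝ} (hε : 0 < ε) : IsUpperTP (bidiag n ε ^ n) := by
  intro k f g hf hg hfg
  have hb : ∀ (t : ℕ) (i : Fin k), min (g i : ℕ) (f i + t) < n := fun t i =>
    (min_le_left _ _).trans_lt (g i).isLt
  let F : ℕ → Fin k → Fin n := fun t i => ⟨min (g i : ℕ) (f i + t), hb t i⟩
  have hF : ∀ t, StrictMono (F t) := by
    intro t i j hij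
    have h1 := Fin.lt_def.1 (hf hij)
    have h2 := Fin.lt_def.1 (hg hij)
    simp only [F, Fin.mk_lt_mk]
    omega
  have key : ∀ t, 0 < ((bidiag n ε ^ t).submatrix f (F t)).det := by
    intro t
    induction t with
    | zero =>
      have : F 0 = f := by
        ext i
        have := Fin.le_def.1 (hfg i)
        simp only [F]
        omega
      rw [this, ((upperUni_bidiag n ε).pow 0).det_principal hf]
      exact one_pos
    | succ t ih =>
      rw [pow_succ]
      refine lt_of_lt_of_le (mul_pos ih ?_) (((isTN_bidiag n hε.le).pow t).minor_mul_minor_le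
        (isTN_bidiag n hε.le) hf (hF t) (hF (t + 1)))
      rw [det_bidiag_submatrix ε k _ _ (hF t) (hF (t + 1))]
      refine Finset.prod_pos fun i _ => ?_
      simp only [bidiag, Matrix.of_apply, F, Fin.mk.injEq]
      split_ifs with h1 h2
      · exact one_pos
      · exact hε
      · omega
  have : F n = g := by
    ext i
    have := (g i).isLt
    simp only [F]
    omega
  rw [← this]
  exact key n

/-! ### Schur complements of the top left entry -/

/-- The Schur complement of the top left entry. -/
noncomputable def schur {m n : ℕ} (A : Matrix (Fin (m + 1)) (Fin (n + 1)) ℝ) :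
    Matrix (Fin m) (Fin n) ℝ :=
  Matrix.of fun i j => A i.succ j.succ - A i.succ 0 * A 0 j.succ / A 0 0

theorem det_eq_mul_det_schur {k : ℕ} (M : Matrix (Fin (k + 1)) (Fin (k + 1)) ℝ)
    (h : M 0 0 ≠ 0) : M.det = M 0 0 * (schur M).det := by
  let M' : Matrix (Fin (k + 1)) (Fin (k + 1)) ℝ :=
    Matrix.of fun i j => if i = 0 then M 0 j else M i j - M i 0 / M 0 0 * M 0 j
  have h1 : M.det = M'.det := by
    refine Matrix.det_eq_of_forall_row_eq_smul_add_const
      (fun i => if i = 0 then 0 else M i 0 / M 0 0) 0 (by simp) fun i j => ?_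
    by_cases hi : i = 0 <;> simp [M', hi]
  rw [h1, Matrix.det_succ_column_zero, Fin.sum_univ_succ, Finset.sum_eq_zero]
  · have : M'.submatrix Fin.succ Fin.succ = schur M := by
      ext i j
      simp [M', schur]
      ring
    simp [this, M']
  · intro i _
    have : M' i.succ 0 = 0 := by
      simp [M']
      field_simp
      simp
    simp [this]

theorem schur_submatrix {m n k l : ℕ} (A : Matrix (Fin (m + 1)) (Fin (n + 1)) ℝ)
    (f : Fin k → Fin m) (g : Fin l → Fin n) :
    (schur A).submatrix f g =
      schur (A.submatrix (Fin.cons 0 (Fin.succ ∘ f) : Fin (k + 1) → Fin (m + 1))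
        (Fin.cons 0 (Fin.succ ∘ g) : Fin (l + 1) → Fin (n + 1))) := by
  ext i j
  simp [schur]

theorem strictMono_cons_succ {k m : ℕ} {f : Fin k → Fin m} (hf : StrictMono f) :
    StrictMono (Fin.cons 0 (Fin.succ ∘ f) : Fin (k + 1) → Fin (m + 1)) := by
  intro i j hij
  induction j using Fin.cases with
  | zero => simp at hij
  | succ j =>
    induction i using Fin.cases with
    | zero => simp
    | succ i => simpa using hf (Fin.succ_lt_succ_iff.1 hij)

theorem IsTN.schur {m n : ℕ} {A : Matrix (Fin (m + 1)) (Fin (n + 1)) ℝ} (hA : IsTN A)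
    (h0 : 0 < A 0 0) : IsTN (schur A) := by
  intro k f g hf hg
  have := hA _ _ _ (strictMono_cons_succ hf) (strictMono_cons_succ hg)
  rw [det_eq_mul_det_schur _ (by simpa using h0.ne'), ← schur_submatrix] at this
  exact nonneg_of_mul_nonneg_right this (by simpa using h0)

theorem IsTN.apply_zero_pos {k : ℕ} {A : Matrix (Fin (k + 1)) (Fin (k + 1)) ℝ} (hA : IsTN A)
    (hd : A.det ≠ 0) : 0 < A 0 0 := by
  refine lt_of_le_of_ne (hA.nonneg 0 0) fun h0 => hd ?_
  by_cases hrow : ∀ j, A 0 j = 0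
  · exact Matrix.det_eq_zero_of_row_eq_zero 0 hrow
  · push Not at hrow
    obtain ⟨j, hj⟩ := hrow
    refine Matrix.det_eq_zero_of_column_eq_zero 0 fun i => ?_
    have hj0 : 0 < j := Fin.pos_iff_ne_zero.2 (by rintro rfl; exact hj h0.symm)
    rcases (Fin.zero_le i).eq_or_lt with rfl | hi
    · exact h0.symm
    · have h1 := hA.mul_le hi hj0
      rw [← h0, zero_mul] at h1
      have h2 : 0 < A 0 j := lt_of_le_of_ne (hA.nonneg 0 j) hj.symm
      nlinarith [hA.nonneg i 0]

theorem IsTN.det_castSucc_ne_zero : ∀ {m : ℕ} {A : Matrix (Fin (m + 1)) (Fin (m + 1)) ℝ},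
    IsTN A → A.det ≠ 0 → (A.submatrix Fin.castSucc Fin.castSucc).det ≠ 0 := by
  intro m
  induction m with
  | zero => intro A _ _; simp
  | succ m ih =>
    intro A hA hd
    have h0 := hA.apply_zero_pos hd
    rw [det_eq_mul_det_schur A h0.ne'] at hd
    have h1 := ih (hA.schur h0) (right_ne_zero_of_mul hd)
    rw [det_eq_mul_det_schur _ (by simpa using h0.ne')]
    exact mul_ne_zero (by simpa using h0.ne') h1

theorem det_submatrix_rev {k m n : ℕ} (A : Matrix (Fin m) (Fin n) ℝ) (f : Fin k → Fin m)
    (g : Fin k → Fin n) : (A.submatrix (f ∘ Fin.rev) (g ∘ Fin.rev)).det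
      = (A.submatrix f g).det :=
  Matrix.det_submatrix_equiv_self Fin.revPerm (A.submatrix f g)

theorem strictMono_rev_comp_rev {k m : ℕ} {f : Fin k → Fin m} (hf : StrictMono f) :
    StrictMono (Fin.rev ∘ f ∘ Fin.rev) := fun _ _ hij =>
  Fin.rev_lt_rev.2 (hf (Fin.rev_lt_rev.2 hij))

theorem IsTN.submatrix_rev {m n : ℕ} {A : Matrix (Fin m) (Fin n) ℝ} (hA : IsTN A) :
    IsTN (A.submatrix Fin.rev Fin.rev) := by
  intro k f g hf hg
  rw [← det_submatrix_rev]
  exact hA _ _ _ (strictMono_rev_comp_rev hf) (strictMono_rev_comp_rev hg)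

theorem IsTN.transpose {m n : ℕ} {A : Matrix (Fin m) (Fin n) ℝ} (hA : IsTN A) :
    IsTN A.transpose := by
  intro k f g hf hg
  rw [← Matrix.det_transpose]
  exact hA _ _ _ hg hf

theorem IsTN.det_succ_ne_zero {m : ℕ} {A : Matrix (Fin (m + 1)) (Fin (m + 1)) ℝ} (hA : IsTN A)
    (hd : A.det ≠ 0) : (A.submatrix Fin.succ Fin.succ).det ≠ 0 := by
  have h1 := hA.submatrix_rev.det_castSucc_ne_zero
    (by rwa [show A.submatrix Fin.rev Fin.rev = A.submatrix Fin.revPerm Fin.revPerm from rfl,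
      Matrix.det_submatrix_equiv_self])
  rw [← det_submatrix_rev]
  have h2 : A.submatrix (Fin.succ ∘ Fin.rev) (Fin.succ ∘ Fin.rev)
      = (A.submatrix Fin.rev Fin.rev).submatrix Fin.castSucc Fin.castSucc := by
    ext i j
    simp [Fin.rev_castSucc]
  rwa [h2]

/-! ### Positivity of all minors from nonvanishing corner minors -/

/-- The index sequence runs through consecutive integers. -/
def IsInterval {k n : ℕ} (f : Fin k → Fin n) : Prop := ∃ a : ℕ, ∀ i, (f i : ℕ) = a + i

theorem IsTN.det_ne_zero_of_interval {n : ℕ} {z : Mat n} (hz : IsTN z)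
    (hc : ∀ (k : ℕ) (f g : Fin k → Fin n), (∀ i, (f i : ℕ) = i) → (∀ i, (g i : ℕ) + k = n + i) →
      (z.submatrix f g).det ≠ 0) {k : ℕ} {f g : Fin k → Fin n} (hf : IsInterval f)
    (hg : IsInterval g) (hfg : ∀ i, f i ≤ g i) : (z.submatrix f g).det ≠ 0 := by
  obtain ⟨a, ha⟩ := hf
  obtain ⟨b, hb⟩ := hg
  rcases k.eq_zero_or_pos with rfl | hk
  · simp
  obtain ⟨d, rfl⟩ : ∃ d, b = a + d := by
    have := Fin.le_def.1 (hfg ⟨0, hk⟩)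
    rw [ha, hb] at this
    exact Nat.exists_eq_add_of_le (by simpa using this)
  have lead : ∀ (t k : ℕ) (f g : Fin k → Fin n), k + t + d = n → (∀ i, (f i : ℕ) = i) →
      (∀ i, (g i : ℕ) = d + i) → (z.submatrix f g).det ≠ 0 := by
    intro t
    induction t with
    | zero =>
      intro k f g hk hf hg
      exact hc k f g hf fun i => by rw [hg]; omega
    | succ t ih =>
      intro k f g hk hf hg
      have h1 := ih (k + 1) (fun i => ⟨i, by omega⟩) (fun i => ⟨d + i, by omega⟩) (by omega)
        (fun i => rfl) (fun i => rfl)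
      have h2 := IsTN.det_castSucc_ne_zero (hz.submatrix (fun i j hij => hij)
        (fun i j hij => Nat.add_lt_add_left hij d)) h1
      rw [Matrix.submatrix_submatrix] at h2
      have hf' : f = (fun i : Fin (k + 1) => (⟨i, by omega⟩ : Fin n)) ∘ Fin.castSucc :=
        funext fun i => Fin.ext (hf i)
      have hg' : g = (fun i : Fin (k + 1) => (⟨d + i, by omega⟩ : Fin n)) ∘ Fin.castSucc :=
        funext fun i => Fin.ext (hg i)
      rwa [hf', hg']
  clear hfg
  induction a generalizing k with
  | zero =>
    refine lead (n - d - k) k f g ?_ (fun i => by simpa using ha i) (fun i => by simpa using hb i)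
    have h1 := hb ⟨k - 1, by omega⟩
    have h2 := (g ⟨k - 1, by omega⟩).isLt
    simp only at h1
    omega
  | succ a ih =>
    have h1 := ha ⟨k - 1, by omega⟩
    have h2 := (f ⟨k - 1, by omega⟩).isLt
    have h3 := hb ⟨k - 1, by omega⟩
    have h4 := (g ⟨k - 1, by omega⟩).isLt
    simp only at h1 h3
    have hn : a + d + k < n := by omega
    clear h1 h2 h3 h4
    have h5 := ih (k := k + 1) (f := fun i => ⟨a + i, by omega⟩)
      (g := fun i => ⟨a + d + i, by omega⟩) (fun i => rfl) (Nat.succ_pos k) (fun i => rfl)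
    have h6 := IsTN.det_succ_ne_zero (hz.submatrix (fun i j hij => Nat.add_lt_add_left hij a)
        (fun i j hij => Nat.add_lt_add_left hij (a + d))) h5
    rw [Matrix.submatrix_submatrix] at h6
    have hf' : f = (fun i : Fin (k + 1) => (⟨a + i, by omega⟩ : Fin n)) ∘ Fin.succ :=
      funext fun i => Fin.ext (by rw [ha]; simp; omega)
    have hg' : g = (fun i : Fin (k + 1) => (⟨a + d + i, by omega⟩ : Fin n)) ∘ Fin.succ :=
      funext fun i => Fin.ext (by rw [hb]; simp; omega)
    rwa [hf', hg']

/-- The alternating vector of maximal minors of a `k × (k + 1)` matrix lies in its kernel. -/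
theorem sum_neg_one_pow_mul_minor {k : ℕ} (W : Matrix (Fin k) (Fin (k + 1)) ℝ) (i : Fin k) :
    ∑ r : Fin (k + 1), (-1 : ℝ) ^ (r : ℕ) * (W.submatrix id r.succAbove).det * W i r = 0 := by
  have h := Matrix.det_zero_of_row_eq
    (M := (Matrix.of (Fin.cons (W i) W) : Matrix (Fin (k + 1)) (Fin (k + 1)) ℝ))
    (Fin.succ_ne_zero i).symm rfl
  rw [Matrix.det_succ_row_zero] at h
  rw [← h]
  refine Finset.sum_congr rfl fun r _ => ?_
  have : (Matrix.of (Fin.cons (W i) W) : Matrix (Fin (k + 1)) (Fin (k + 1)) ℝ).submatrix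
      Fin.succ r.succAbove = W.submatrix id r.succAbove := rfl
  rw [this]
  change _ = (-1 : ℝ) ^ (r : ℕ) * W i r * _
  ring

/-- If a maximal minor obtained by deleting an interior column vanishes, then so does the one
obtained by deleting the first column. -/
theorem minor_zero_eq_zero {K : ℕ} (W : Matrix (Fin (K + 1)) (Fin (K + 2)) ℝ) (r : Fin (K + 2))
    (hr0 : r ≠ 0) (hr1 : r ≠ Fin.last _)
    (hW : ∀ s : Fin (K + 2), 0 ≤ (W.submatrix id s.succAbove).det)
    (hC : ∀ q : Fin (K + 1),
      0 < (W.submatrix Fin.castSucc (r.succAbove ∘ q.succAbove)).det)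
    (hr : (W.submatrix id r.succAbove).det = 0) :
    (W.submatrix id (Fin.succAbove 0)).det = 0 := by
  set D : Fin (K + 2) → ℝ := fun s => (W.submatrix id s.succAbove).det with hD
  set C : Fin (K + 1) → ℝ := fun q =>
    (W.submatrix Fin.castSucc (r.succAbove ∘ q.succAbove)).det with hCdef
  have k1 : ∀ i : Fin K, ∑ q : Fin (K + 1),
      (-1 : ℝ) ^ (r.succAbove q : ℕ) * D (r.succAbove q) * W i.castSucc (r.succAbove q) = 0 := by
    intro i
    have h := sum_neg_one_pow_mul_minor W i.castSucc
    rw [Fin.sum_univ_succAbove _ r, hr] at h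
    simpa using h
  have k2 : ∀ i : Fin K, ∑ q : Fin (K + 1),
      (-1 : ℝ) ^ (q : ℕ) * C q * W i.castSucc (r.succAbove q) = 0 := fun i =>
    sum_neg_one_pow_mul_minor (W.submatrix Fin.castSucc r.succAbove) i
  have hs0 : r.succAbove 0 = 0 := Fin.succAbove_ne_zero_zero hr0
  have hsl : r.succAbove (Fin.last K) = Fin.last _ := Fin.succAbove_ne_last_last hr1
  let x : Fin (K + 1) → ℝ := fun q =>
    (-1 : ℝ) ^ (r.succAbove q : ℕ) * D (r.succAbove q) * C 0 - (-1 : ℝ) ^ (q : ℕ) * C q * D 0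
  have hx0 : x 0 = 0 := by simp [x, hs0]; ring
  have hx : ∀ i : Fin K, ∑ q : Fin (K + 1), W i.castSucc (r.succAbove q) * x q = 0 := by
    intro i
    have : ∑ q : Fin (K + 1), W i.castSucc (r.succAbove q) * x q
        = (∑ q : Fin (K + 1),
            (-1 : ℝ) ^ (r.succAbove q : ℕ) * D (r.succAbove q) * W i.castSucc (r.succAbove q)) * C 0
          - (∑ q : Fin (K + 1),
            (-1 : ℝ) ^ (q : ℕ) * C q * W i.castSucc (r.succAbove q)) * D 0 := by
      rw [Finset.sum_mul, Finset.sum_mul, ← Finset.sum_sub_distrib]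
      refine Finset.sum_congr rfl fun q _ => ?_
      simp only [x]
      ring
    rw [this, k1, k2]
    simp
  have hxs : x ∘ Fin.succ = 0 := by
    refine Matrix.eq_zero_of_mulVec_eq_zero (hC 0).ne' ?_
    ext i
    have h := hx i
    rw [Fin.sum_univ_succ, hx0, mul_zero, zero_add] at h
    simpa [Matrix.mulVec, dotProduct] using h
  have hxl : x (Fin.last K) = 0 := by
    rcases Fin.eq_zero_or_eq_succ (Fin.last K) with h | ⟨j, h⟩
    · rw [h, hx0]
    · rw [h]; exact congrFun hxs j
  simp only [x, hsl, Fin.val_last, pow_succ] at hxl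
  have h1 : D (Fin.last (K + 1)) * C 0 + C (Fin.last K) * D 0 = 0 := by
    have h2 : (-1 : ℝ) ^ K * (D (Fin.last (K + 1)) * C 0 + C (Fin.last K) * D 0) = 0 := by
      linear_combination -hxl
    exact (mul_eq_zero.1 h2).resolve_left (by simp)
  have h2 : 0 ≤ D (Fin.last (K + 1)) * C 0 := mul_nonneg (hW _) (hC 0).le
  have h3 : 0 ≤ C (Fin.last K) * D 0 := mul_nonneg (hC _).le (hW 0)
  exact (mul_eq_zero.1 (by linarith : C (Fin.last K) * D 0 = 0)).resolve_left (hC _).ne'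

theorem exists_gap {K n : ℕ} {g : Fin (K + 1) → Fin n} (hg : StrictMono g)
    (h : ¬ IsInterval g) : ∃ p : Fin K, (g p.castSucc : ℕ) + 1 < g p.succ := by
  by_contra! hcon
  refine h ⟨g 0, fun i => ?_⟩
  induction i using Fin.induction with
  | zero => simp
  | succ i ih =>
    have h1 := hcon i
    have h2 := Fin.lt_def.1 (hg (Fin.castSucc_lt_succ (i := i)))
    simp at ih ⊢
    omega

theorem strictMono_insertNth {K n : ℕ} {g : Fin (K + 1) → Fin n} (hg : StrictMono g)
    (p : Fin K) {b : Fin n} (h1 : g p.castSucc < b) (h2 : b < g p.succ) :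
    StrictMono (Fin.insertNth (α := fun _ => Fin n) p.succ.castSucc b g) := by
  intro i j hij
  rcases Fin.eq_self_or_eq_succAbove p.succ.castSucc i with rfl | ⟨i, rfl⟩ <;>
  rcases Fin.eq_self_or_eq_succAbove p.succ.castSucc j with rfl | ⟨j, rfl⟩
  · simp at hij
  · simp only [Fin.insertNth_apply_same, Fin.insertNth_apply_succAbove]
    refine h2.trans_le (hg.monotone ?_)
    rw [Fin.lt_succAbove_iff_le_castSucc] at hij
    exact Fin.castSucc_lt_iff_succ_le.1 (by simpa using hij)
  · simp only [Fin.insertNth_apply_same, Fin.insertNth_apply_succAbove]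
    refine lt_of_le_of_lt (hg.monotone ?_) h1
    rw [Fin.succAbove_lt_iff_castSucc_lt] at hij
    simp only [Fin.lt_def, Fin.le_def, Fin.val_castSucc, Fin.val_succ] at hij ⊢
    omega
  · simp only [Fin.insertNth_apply_succAbove]
    exact hg (by simpa using hij)

/-- Nonvanishing of the minors on consecutive columns implies nonvanishing of all minors that do
not vanish identically. -/
theorem IsTN.det_ne_zero_of_interval_columns {n : ℕ} {z : Mat n} (hz : IsTN z)
    (P : ∀ {k : ℕ}, (Fin k → Fin n) → Prop)
    (hP : ∀ {k : ℕ} {f : Fin (k + 1) → Fin n}, P f → P (f ∘ Fin.castSucc))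
    (hint : ∀ (k : ℕ) (f g : Fin k → Fin n), P f → StrictMono f → StrictMono g →
      (∀ i, f i ≤ g i) → IsInterval g → (z.submatrix f g).det ≠ 0) :
    ∀ (k : ℕ) (f g : Fin k → Fin n), P f → StrictMono f → StrictMono g →
      (∀ i, f i ≤ g i) → (z.submatrix f g).det ≠ 0 := by
  intro k
  induction k with
  | zero => intros; simp
  | succ K ih =>
    intro f
    have main : ∀ (s : ℕ) (g : Fin (K + 1) → Fin n), n - (g 0 : ℕ) = s → P f → StrictMono f →
        StrictMono g → (∀ i, f i ≤ g i) → (z.submatrix f g).det ≠ 0 := by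
      intro s
      induction s using Nat.strong_induction_on with
      | _ s ihs =>
        intro g hs hPf hf hg hfg hzero
        by_cases hI : IsInterval g
        · exact hint _ f g hPf hf hg hfg hI hzero
        obtain ⟨p, hp⟩ := exists_gap hg hI
        have hb : (g p.castSucc : ℕ) + 1 < n := hp.trans (g p.succ).isLt
        set r : Fin (K + 2) := p.succ.castSucc with hr
        set h : Fin (K + 2) → Fin n :=
          Fin.insertNth (α := fun _ => Fin n) r ⟨(g p.castSucc : ℕ) + 1, hb⟩ g with hh
        have hmono : StrictMono h := strictMono_insertNth hg p
          (Fin.lt_def.2 (Nat.lt_succ_self _)) (Fin.lt_def.2 hp)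
        have hhg : ∀ i, h (r.succAbove i) = g i := fun i => by simp [hh]
        have hr0 : r ≠ 0 := by simp [hr, Fin.ext_iff]
        have hr1 : r ≠ Fin.last _ := by
          have := p.isLt
          simp [hr, Fin.ext_iff]
          omega
        have hle : ∀ i : Fin (K + 1), g i ≤ h i.succ := by
          intro i
          rw [← hhg i]
          refine hmono.monotone ?_
          rw [Fin.succAbove]
          split_ifs
          · exact (Fin.castSucc_lt_succ).le
          · exact le_rfl
        have h0 : g 0 < h (Fin.succ 0) := by
          rw [← hhg 0, Fin.succAbove_ne_zero_zero hr0]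
          exact hmono (Fin.succ_pos 0)
        refine ihs (n - (h (Fin.succ 0) : ℕ)) ?_ (h ∘ Fin.succ) rfl hPf hf
          (hmono.comp Fin.strictMono_succ) (fun i => (hfg i).trans (hle i)) ?_
        · have := (h (Fin.succ 0)).isLt
          have := Fin.lt_def.1 h0
          omega
        · have := minor_zero_eq_zero (z.submatrix f h) r hr0 hr1
            (fun s => hz _ _ _ hf (hmono.comp (Fin.strictMono_succAbove s))) ?_ ?_
          · simpa using this
          · intro q
            have h2 : (z.submatrix f h).submatrix Fin.castSucc (r.succAbove ∘ q.succAbove)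
                = z.submatrix (f ∘ Fin.castSucc) (g ∘ q.succAbove) := by
              ext i j
              simp [hhg]
            have hf' : StrictMono (f ∘ Fin.castSucc) := hf.comp Fin.strictMono_castSucc
            have hg' : StrictMono (g ∘ q.succAbove) := hg.comp (Fin.strictMono_succAbove q)
            rw [h2]
            refine lt_of_le_of_ne (hz _ _ _ hf' hg') (ih _ _ (hP hPf) hf' hg' fun i => ?_).symm
            refine (hf.monotone ?_).trans (hfg _)
            rw [Fin.succAbove]
            split_ifs
            · exact le_rfl
            · exact (Fin.castSucc_lt_succ).le
          · have h2 : (z.submatrix f h).submatrix id r.succAbove = z.submatrix f g := by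
              ext i j
              simp [hhg]
            rw [h2, hzero]
    exact fun g => main _ g rfl

/-- A totally nonnegative matrix with nonzero upper right corner minors has positive minors
`Δ_{I,J}` for all `I ≤ J`. -/
theorem IsTN.isUpperTP {n : ℕ} {z : Mat n} (hz : IsTN z)
    (hc : ∀ (k : ℕ) (f g : Fin k → Fin n), (∀ i, (f i : ℕ) = i) → (∀ i, (g i : ℕ) + k = n + i) →
      (z.submatrix f g).det ≠ 0) : IsUpperTP z := by
  have hrows := hz.det_ne_zero_of_interval_columns (fun f => IsInterval f)
    (fun ⟨a, ha⟩ => ⟨a, fun i => by simp [ha]⟩)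
    (fun k f g hf _ _ hfg hg => hz.det_ne_zero_of_interval hc hf hg hfg)
  have hall := hz.transpose.submatrix_rev.det_ne_zero_of_interval_columns (fun _ => True)
    (fun _ => trivial) (fun k f g _ hf hg hfg hI => by
      rw [← det_submatrix_rev, ← Matrix.det_transpose]
      refine hrows k (Fin.rev ∘ g ∘ Fin.rev) (Fin.rev ∘ f ∘ Fin.rev) ?_
        (strictMono_rev_comp_rev hg) (strictMono_rev_comp_rev hf)
        (fun i => Fin.rev_le_rev.2 (hfg _))
      obtain ⟨a, ha⟩ := hI
      refine ⟨n - a - k, fun i => ?_⟩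
      have h1 := ha (Fin.rev ⟨0, i.pos⟩)
      have h2 := (g (Fin.rev ⟨0, i.pos⟩)).isLt
      have h3 := ha (Fin.rev i)
      simp only [Function.comp, Fin.val_rev] at h1 h3 ⊢
      omega)
  intro k f g hf hg hfg
  refine lt_of_le_of_ne (hz k f g hf hg) (Ne.symm ?_)
  have := hall k (Fin.rev ∘ g ∘ Fin.rev) (Fin.rev ∘ f ∘ Fin.rev) trivial
    (strictMono_rev_comp_rev hg) (strictMono_rev_comp_rev hf) (fun i => Fin.rev_le_rev.2 (hfg _))
  rw [← det_submatrix_rev, ← Matrix.det_transpose] at this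
  convert this using 3
  ext i j
  simp

/-! ### Triangular matrices -/

theorem upperUni.det_eq_one {n : ℕ} {x : Mat n} (hx : upperUni x) : x.det = 1 := by
  simpa using hx.det_principal (f := id) strictMono_id

theorem upperUni.isUnit_det {n : ℕ} {x : Mat n} (hx : upperUni x) : IsUnit x.det := by
  simp [hx.det_eq_one]

theorem upperUni.inv {n : ℕ} {x : Mat n} (hx : upperUni x) : upperUni x⁻¹ := by
  let := x.invertibleOfIsUnitDet hx.isUnit_det
  have h1 : x⁻¹.BlockTriangular id :=
    Matrix.blockTriangular_inv_of_blockTriangular fun i j h => hx.2 i j h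
  refine ⟨fun i => ?_, fun i j h => h1 h⟩
  have h2 : (x * x⁻¹) i i = 1 := by simp
  rw [Matrix.mul_apply, Finset.sum_eq_single i] at h2
  · simpa [hx.1] using h2
  · intro j _ hj
    rcases lt_or_gt_of_ne hj with h | h
    · simp [hx.2 i j h]
    · simp [h1 (show id i < id j from h)]
  · simp

theorem lowerUni_iff_transpose {n : ℕ} {x : Mat n} : lowerUni x ↔ upperUni x.transpose :=
  ⟨fun h => ⟨h.1, fun i j hij => h.2 j i hij⟩, fun h => ⟨h.1, fun i j hij => h.2 j i hij⟩⟩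

theorem lowerUni.lowerTriInv {n : ℕ} {x : Mat n} (hx : lowerUni x) : lowerTriInv x := by
  refine ⟨?_, hx.2⟩
  rw [← Matrix.det_transpose]
  exact (lowerUni_iff_transpose.1 hx).isUnit_det

theorem lowerTriInv.mul {n : ℕ} {x y : Mat n} (hx : lowerTriInv x) (hy : lowerTriInv y) :
    lowerTriInv (x * y) := by
  have h1 : x.BlockTriangular OrderDual.toDual := fun i j h => hx.2 i j h
  have h2 : y.BlockTriangular OrderDual.toDual := fun i j h => hy.2 i j h
  exact ⟨by rw [Matrix.det_mul]; exact hx.1.mul hy.1, fun i j h => (h1.mul h2) h⟩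

theorem lowerTriInv.inv {n : ℕ} {x : Mat n} (hx : lowerTriInv x) : lowerTriInv x⁻¹ := by
  let := x.invertibleOfIsUnitDet hx.1
  have h1 : x⁻¹.BlockTriangular OrderDual.toDual :=
    Matrix.blockTriangular_inv_of_blockTriangular fun i j h => hx.2 i j h
  exact ⟨Matrix.isUnit_nonsing_inv_det x hx.1, fun i j h => h1 h⟩

theorem lowerTriInv.apply_self_ne_zero {n : ℕ} {x : Mat n} (hx : lowerTriInv x) (i : Fin n) :
    x i i ≠ 0 := by
  have h := hx.1
  rw [Matrix.det_of_isLowerTriangular x fun i j hij => hx.2 i j hij] at h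
  exact Finset.prod_ne_zero_iff.1 h.ne_zero i (Finset.mem_univ i)

theorem det_submatrix_self_ne_zero_of_upper {n k : ℕ} {x : Mat n}
    (hx : ∀ i j : Fin n, j < i → x i j = 0) (hd : ∀ i, x i i ≠ 0) {p : Fin k → Fin n}
    (hp : Function.Injective p) : (x.submatrix p p).det ≠ 0 := by
  obtain ⟨σ, hσ⟩ := exists_perm_strictMono hp
  rw [← Matrix.det_submatrix_equiv_self σ, Matrix.submatrix_submatrix,
    Matrix.det_of_isUpperTriangular (M := x.submatrix (p ∘ σ) (p ∘ σ))
      fun i j hij => hx _ _ (hσ hij)]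
  exact Finset.prod_ne_zero_iff.2 fun i _ => hd _

theorem det_submatrix_self_ne_zero_of_lower {n k : ℕ} {x : Mat n} (hx : lowerTriInv x)
    {p : Fin k → Fin n} (hp : Function.Injective p) : (x.submatrix p p).det ≠ 0 := by
  rw [← Matrix.det_transpose]
  exact det_submatrix_self_ne_zero_of_upper (x := x.transpose) (fun i j h => hx.2 j i h)
    hx.apply_self_ne_zero hp

theorem lower_mul_submatrix {n k l : ℕ} {x : Mat n} (hx : ∀ i j : Fin n, i < j → x i j = 0)
    (y : Mat n) {f : Fin k → Fin n} (hf : ∀ i, (f i : ℕ) = i) (g : Fin l → Fin n) :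
    (x * y).submatrix f g = x.submatrix f f * y.submatrix f g := by
  ext i j
  simp only [Matrix.submatrix_apply, Matrix.mul_apply]
  refine (Fintype.sum_of_injective f (fun a b h => Fin.ext (by rw [← hf, ← hf, h])) _ _
    (fun c hc => ?_) fun _ => rfl).symm
  rw [hx _ _ ?_, zero_mul]
  by_contra! hcon
  refine hc ⟨⟨c, ?_⟩, Fin.ext (hf _)⟩
  have := Fin.le_def.1 hcon
  rw [hf] at this
  omega

theorem mul_lower_submatrix {n k l : ℕ} (x : Mat n) {y : Mat n}
    (hy : ∀ i j : Fin n, i < j → y i j = 0) (f : Fin l → Fin n) {g : Fin k → Fin n}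
    (hg : ∀ i, (g i : ℕ) + k = n + i) :
    (x * y).submatrix f g = x.submatrix f g * y.submatrix g g := by
  ext i j
  simp only [Matrix.submatrix_apply, Matrix.mul_apply]
  refine (Fintype.sum_of_injective g (fun a b h => Fin.ext ?_) _ _
    (fun c hc => ?_) fun _ => rfl).symm
  · have h1 := hg a
    have h2 := hg b
    rw [h] at h1
    omega
  rw [hy _ _ ?_, mul_zero]
  by_contra! hcon
  have h1 := Fin.le_def.1 hcon
  have h2 := hg j
  have h3 := (g j).isLt
  refine hc ⟨⟨c + k - n, ?_⟩, Fin.ext ?_⟩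
  · omega
  · have h4 := hg ⟨c + k - n, by omega⟩
    simp only at h4
    omega

/-! ### Gaussian decomposition -/

/-- All leading principal minors are nonzero. -/
def LeadNZ {n : ℕ} (g : Mat n) : Prop :=
  ∀ (k : ℕ) (f : Fin k → Fin n), (∀ i, (f i : ℕ) = i) → (g.submatrix f f).det ≠ 0

theorem LeadNZ.apply_zero_ne_zero {n : ℕ} {g : Mat (n + 1)} (hg : LeadNZ g) : g 0 0 ≠ 0 := by
  simpa using hg 1 (fun _ => 0) (by simp)

theorem LeadNZ.schur {n : ℕ} {g : Mat (n + 1)} (hg : LeadNZ g) : LeadNZ (schur g) := by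
  intro k f hf
  have h := hg (k + 1) (Fin.cons 0 (Fin.succ ∘ f)) (Fin.cases rfl fun i => by simp [hf])
  rw [det_eq_mul_det_schur _ (by simpa using hg.apply_zero_ne_zero), ← schur_submatrix] at h
  exact right_ne_zero_of_mul h

/-- The upper unitriangular factor of the Gaussian decomposition, by Gaussian elimination. -/
noncomputable def elimUpper : ∀ {n : ℕ}, Mat n → Mat n
  | 0, _ => 1
  | _ + 1, g => Matrix.of (Fin.cons (fun j => g 0 j / g 0 0)
      fun i => Fin.cons 0 (elimUpper (schur g) i))

theorem LeadNZ.exists_eq_mul : ∀ {n : ℕ} {g : Mat n}, LeadNZ g → ∀ (R : Fin n → Fin n → Prop),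
    (∀ i, R i i) → (∀ i j k, R i j → R j k → R i k) → (∀ i j, g i j ≠ 0 → R i j) →
    upperUni (elimUpper g) ∧ (∀ i j, elimUpper g i j ≠ 0 → R i j) ∧
      ∃ L : Mat n, (∀ i j : Fin n, i < j → L i j = 0) ∧ (∀ i j, L i j ≠ 0 → R i j) ∧
        g = L * elimUpper g := by
  intro n
  induction n with
  | zero =>
    intro g _ R _ _ _
    exact ⟨⟨fun i => i.elim0, fun i => i.elim0⟩, fun i => i.elim0, 1, fun i => i.elim0,
      fun i => i.elim0, by ext i; exact i.elim0⟩
  | succ n ih =>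
    intro g hg R hrefl htrans hR
    have h0 := hg.apply_zero_ne_zero
    obtain ⟨h1, h2, L, h3, h4, h5⟩ := ih hg.schur (fun i j => R i.succ j.succ) (fun i => hrefl _)
      (fun i j k => htrans _ _ _) (fun i j hij => by
        by_contra hcon
        have e1 : g i.succ j.succ = 0 := by_contra fun h => hcon (hR _ _ h)
        have e2 : g i.succ 0 * g 0 j.succ = 0 := by
          by_contra h
          exact hcon (htrans _ _ _ (hR _ _ (left_ne_zero_of_mul h))
            (hR _ _ (right_ne_zero_of_mul h)))
        exact hij (by simp [BruhatTNN.schur, e1, e2]))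
    have b0 : ∀ j, elimUpper g 0 j = g 0 j / g 0 0 := fun j => rfl
    have bs : ∀ i, elimUpper g (Fin.succ i) 0 = 0 := fun i => rfl
    have bss : ∀ i j, elimUpper g (Fin.succ i) (Fin.succ j) = elimUpper (BruhatTNN.schur g) i j :=
      fun i j => rfl
    let M : Mat (n + 1) := Matrix.of (Fin.cons (Fin.cons (g 0 0) 0)
      fun i => Fin.cons (g i.succ 0) (L i))
    have m0 : M 0 0 = g 0 0 := rfl
    have m0s : ∀ j : Fin n, M 0 j.succ = 0 := fun j => rfl
    have ms : ∀ i : Fin n, M i.succ 0 = g i.succ 0 := fun i => rfl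
    have mss : ∀ i j : Fin n, M i.succ j.succ = L i j := fun i j => rfl
    clear_value M
    refine ⟨⟨fun i => ?_, fun i j => ?_⟩, fun i j => ?_, M, fun i j => ?_, fun i j => ?_, ?_⟩
    · cases i using Fin.cases with
      | zero => rw [b0, div_self h0]
      | succ i => rw [bss, h1.1]
    · cases i using Fin.cases with
      | zero => simp
      | succ i =>
        cases j using Fin.cases with
        | zero => simp [bs]
        | succ j => rw [bss, Fin.succ_lt_succ_iff]; exact h1.2 i j
    · cases i using Fin.cases with
      | zero =>
        intro h
        exact hR _ _ fun h' => h (by rw [b0, h', zero_div])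
      | succ i =>
        cases j using Fin.cases with
        | zero => simp [bs]
        | succ j => rw [bss]; exact h2 i j
    · cases j using Fin.cases with
      | zero => simp
      | succ j =>
        cases i using Fin.cases with
        | zero => simp [m0s]
        | succ i => rw [mss, Fin.succ_lt_succ_iff]; exact h3 i j
    · cases i using Fin.cases with
      | zero =>
        cases j using Fin.cases with
        | zero => exact fun _ => hrefl _
        | succ j => simp [m0s]
      | succ i =>
        cases j using Fin.cases with
        | zero => rw [ms]; exact hR _ _
        | succ j => rw [mss]; exact h4 i j
    · ext i j
      rw [Matrix.mul_apply, Fin.sum_univ_succ, b0]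
      cases i using Fin.cases with
      | zero => simp [m0, m0s]; field_simp
      | succ i =>
        simp only [ms, mss]
        cases j using Fin.cases with
        | zero => simp [bs]; field_simp
        | succ j =>
          simp only [bss]
          have := congrFun (congrFun h5 i) j
          rw [Matrix.mul_apply] at this
          rw [← this]
          simp [BruhatTNN.schur]
          ring

theorem LeadNZ.upperUni_elimUpper {n : ℕ} {g : Mat n} (hg : LeadNZ g) : upperUni (elimUpper g) :=
  (hg.exists_eq_mul (fun _ _ => True) (fun _ => trivial) (fun _ _ _ _ _ => trivial)
    fun _ _ _ => trivial).1

theorem LeadNZ.exists_lowerTriInv {n : ℕ} {g : Mat n} (hg : LeadNZ g) :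
    ∃ L, lowerTriInv L ∧ g = L * elimUpper g := by
  obtain ⟨h1, -, L, h2, -, h3⟩ := hg.exists_eq_mul (fun _ _ => True) (fun _ => trivial)
    (fun _ _ _ _ _ => trivial) fun _ _ _ => trivial
  refine ⟨L, ⟨?_, h2⟩, h3⟩
  have := hg n id fun _ => rfl
  rw [Matrix.submatrix_id_id, h3, Matrix.det_mul] at this
  exact (left_ne_zero_of_mul this).isUnit

theorem lowerTriInv.leadNZ_mul {n : ℕ} {L b : Mat n} (hL : lowerTriInv L) (hb : LeadNZ b) :
    LeadNZ (L * b) := by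
  intro k f hf
  rw [lower_mul_submatrix hL.2 b hf, Matrix.det_mul]
  exact mul_ne_zero (det_submatrix_self_ne_zero_of_lower hL
    fun a b h => Fin.ext (by rw [← hf, ← hf, h])) (hb k f hf)

theorem upperUni.leadNZ {n : ℕ} {b : Mat n} (hb : upperUni b) : LeadNZ b := by
  intro k f hf
  exact det_submatrix_self_ne_zero_of_upper hb.2 (by simp [hb.1])
    fun a b h => Fin.ext (by rw [← hf, ← hf, h])

theorem upper_factor_unique {n : ℕ} {L L' b b' : Mat n} (hL : lowerTriInv L)
    (hL' : lowerTriInv L') (hb : upperUni b) (hb' : upperUni b') (h : L * b = L' * b') :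
    b = b' := by
  have h1 : L'⁻¹ * L = b' * b⁻¹ := by
    calc L'⁻¹ * L = L'⁻¹ * (L * b) * b⁻¹ := by
          rw [Matrix.mul_assoc, Matrix.mul_nonsing_inv_cancel_right _ _ hb.isUnit_det]
      _ = b' * b⁻¹ := by rw [h, Matrix.nonsing_inv_mul_cancel_left _ _ hL'.1]
  have h2 := hb'.mul hb.inv
  have h3 : b' * b⁻¹ = 1 := by
    ext i j
    rcases lt_trichotomy i j with hij | rfl | hij
    · rw [← h1, (hL'.inv.mul hL).2 i j hij, Matrix.one_apply_ne hij.ne]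
    · rw [h2.1, Matrix.one_apply_eq]
    · rw [h2.2 i j hij, Matrix.one_apply_ne hij.ne']
  calc b = b' * b⁻¹ * b := by rw [h3, one_mul]
    _ = b' := Matrix.nonsing_inv_mul_cancel_right _ _ hb.isUnit_det

theorem elimUpper_mul {n : ℕ} {L b : Mat n} (hL : lowerTriInv L) (hb : upperUni b) :
    elimUpper (L * b) = b := by
  have h := hL.leadNZ_mul hb.leadNZ
  obtain ⟨L', hL', e⟩ := h.exists_lowerTriInv
  exact (upper_factor_unique hL hL' hb h.upperUni_elimUpper e).symm

theorem hasGauss_of_eq_mul {n : ℕ} {g L b : Mat n} (hL : lowerTriInv L) (hb : upperUni b)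
    (h : g = L * b) : hasGauss g := by
  refine ⟨L * Matrix.diagonal fun i => (L i i)⁻¹, Matrix.diagonal fun i => L i i, b,
    ⟨fun i => ?_, fun i j hij => ?_⟩, ⟨?_, fun i j hij => Matrix.diagonal_apply_ne _ hij⟩, hb, ?_⟩
  · simp [hL.apply_self_ne_zero]
  · simp [hL.2 i j hij]
  · rw [Matrix.det_diagonal]
    exact (Finset.prod_ne_zero_iff.2 fun i _ => hL.apply_self_ne_zero i).isUnit
  · rw [Matrix.mul_assoc L, Matrix.diagonal_mul_diagonal]
    simp [hL.apply_self_ne_zero, h]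

theorem hasGauss.exists_eq_mul {n : ℕ} {g : Mat n} (hg : hasGauss g) :
    ∃ L, lowerTriInv L ∧ upperUni (gaussPlus g) ∧ g = L * gaussPlus g := by
  have h := hg.choose_spec.choose_spec.choose_spec
  refine ⟨hg.choose * hg.choose_spec.choose, h.1.lowerTriInv.mul ⟨h.2.1.1,
    fun i j hij => h.2.1.2 i j hij.ne⟩, ?_⟩
  rw [gaussPlus, dif_pos hg]
  exact ⟨h.2.2.1, h.2.2.2⟩

theorem hasGauss.leadNZ {n : ℕ} {g : Mat n} (hg : hasGauss g) : LeadNZ g := by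
  obtain ⟨L, hL, hb, e⟩ := hg.exists_eq_mul
  rw [e]
  exact hL.leadNZ_mul hb.leadNZ

theorem gaussPlus_mul {n : ℕ} {L b : Mat n} (hL : lowerTriInv L) (hb : upperUni b) :
    gaussPlus (L * b) = b := by
  obtain ⟨L', hL', hb', e⟩ := (hasGauss_of_eq_mul hL hb rfl).exists_eq_mul
  exact (upper_factor_unique hL hL' hb hb' e).symm

theorem LeadNZ.continuousAt_elimUpper : ∀ {n : ℕ} {g : Mat n}, LeadNZ g →
    ContinuousAt (elimUpper : Mat n → Mat n) g := by
  intro n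
  induction n with
  | zero => intro g _; exact continuousAt_const
  | succ n ih =>
    intro g hg
    have h0 := hg.apply_zero_ne_zero
    have c : ∀ i j, ContinuousAt (fun h : Mat (n + 1) => h i j) g := fun i j =>
      (continuous_id.matrix_elem i j).continuousAt
    have hs : ContinuousAt (fun h : Mat (n + 1) => BruhatTNN.schur h) g := by
      refine continuousAt_pi.2 fun i => continuousAt_pi.2 fun j => ?_
      exact (c _ _).sub (((c _ _).mul (c _ _)).div (c _ _) h0)
    have hc := ContinuousAt.comp (f := fun h : Mat (n + 1) => BruhatTNN.schur h) (ih hg.schur) hs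
    refine continuousAt_pi.2 (Fin.cases (continuousAt_pi.2 fun j => ?_)
      fun i => continuousAt_pi.2 (Fin.cases ?_ fun j => ?_))
    · exact (c 0 j).div (c 0 0) h0
    · exact continuousAt_const
    · exact continuousAt_pi.1 (continuousAt_pi.1 hc i) j

theorem upperUni.continuousAt_inv {n : ℕ} {b : Mat n} (hb : upperUni b) :
    ContinuousAt (Inv.inv : Mat n → Mat n) b := by
  refine continuousAt_matrix_inv b ?_
  rw [Ring.inverse_eq_inv']
  exact continuousAt_inv₀ (by simp [hb.det_eq_one])

/-! ### Conjugation by permutation matrices -/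

theorem mul_permMat {n : ℕ} (x : Mat n) (w : Equiv.Perm (Fin n)) :
    x * permMat w = x.submatrix id w := by
  ext i j
  simp [permMat, Matrix.mul_apply]

theorem permMat_inv_mul_mul {n : ℕ} (u : Equiv.Perm (Fin n)) (y : Mat n) :
    permMat u⁻¹ * y * permMat u = y.submatrix u u := by
  ext i j
  rw [mul_permMat, Matrix.submatrix_apply, id, Matrix.mul_apply, Finset.sum_eq_single (u i)]
  · simp [permMat]
  · intro k _ hk
    have : i ≠ u.symm k := fun h => hk (by simp [h])
    simp [permMat, this]
  · simp

theorem permMat_mul_mul_inv {n : ℕ} (u : Equiv.Perm (Fin n)) (y : Mat n) :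
    permMat u * y * permMat u⁻¹ = y.submatrix u.symm u.symm := by
  simpa using permMat_inv_mul_mul u⁻¹ y

theorem upperUni_submatrix_symm {n : ℕ} {u : Equiv.Perm (Fin n)} {x : Mat n}
    (h1 : ∀ i, x i i = 1) (h2 : ∀ i j, x i j ≠ 0 → u i ≤ u j) :
    upperUni (x.submatrix u.symm u.symm) := by
  refine ⟨fun i => h1 _, fun i j hij => ?_⟩
  by_contra h
  have := h2 _ _ h
  simp only [Equiv.apply_symm_apply] at this
  exact absurd hij this.not_gt

theorem mem_Nminus_iff {n : ℕ} {u : Equiv.Perm (Fin n)} {x : Mat n} :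
    x ∈ Nminus u ↔ lowerUni x ∧ ∃ y : Mat n, upperUni y ∧ x = y.submatrix u u := by
  simp only [Nminus, permMat_inv_mul_mul, Set.mem_ofPred_eq]

theorem mem_Ngrp_iff {n : ℕ} {u : Equiv.Perm (Fin n)} {x : Mat n} :
    x ∈ Ngrp u ↔ upperUni x ∧ ∃ y : Mat n, upperUni y ∧ x = y.submatrix u u := by
  simp only [Ngrp, permMat_inv_mul_mul, Set.mem_ofPred_eq]

theorem inv_mem_Ngrp {n : ℕ} {u : Equiv.Perm (Fin n)} {x : Mat n} (hx : x ∈ Ngrp u) :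
    x⁻¹ ∈ Ngrp u := by
  rw [mem_Ngrp_iff] at hx ⊢
  obtain ⟨h, y, hy, rfl⟩ := hx
  exact ⟨h.inv, y⁻¹, hy.inv, Matrix.inv_submatrix_equiv y u u⟩

theorem upperUni.leadNZ_submatrix {n : ℕ} {c : Mat n} (hc : upperUni c)
    (u : Equiv.Perm (Fin n)) : LeadNZ (c.submatrix u u) := by
  intro k f hf
  rw [Matrix.submatrix_submatrix]
  exact det_submatrix_self_ne_zero_of_upper hc.2 (by simp [hc.1])
    (u.injective.comp fun a b h => Fin.ext (by rw [← hf, ← hf, h]))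

theorem leadNZ_of_mem_Ncell {n : ℕ} {u : Equiv.Perm (Fin n)} {y : Mat n} (hy : y ∈ Ncell u) :
    LeadNZ (y.submatrix id u.symm) := by
  obtain ⟨-, b₁, b₂, h₁, h₂, rfl⟩ := hy
  have : (b₁ * permMat u * b₂).submatrix id u.symm = b₁ * b₂.submatrix u.symm u.symm := by
    rw [← permMat_mul_mul_inv, show (u.symm : Fin n → Fin n) = ⇑u⁻¹ from rfl, ← mul_permMat]
    simp only [Matrix.mul_assoc]
  rw [this]
  refine h₁.leadNZ_mul fun k f hf => ?_
  rw [Matrix.submatrix_submatrix]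
  exact det_submatrix_self_ne_zero_of_lower h₂
    (u.symm.injective.comp fun a b h => Fin.ext (by rw [← hf, ← hf, h]))

theorem factor_mem_of_conj {n : ℕ} {c : Mat n} (hc : upperUni c) (u : Equiv.Perm (Fin n)) :
    elimUpper (c.submatrix u u) ∈ Ngrp u ∧
      ∃ m ∈ Nminus u, c.submatrix u u = m * elimUpper (c.submatrix u u) := by
  obtain ⟨h1, h2, L, h3, h4, h5⟩ := (hc.leadNZ_submatrix u).exists_eq_mul (fun i j => u i ≤ u j)
    (fun i => le_rfl) (fun i j k => le_trans) (fun i j hij => by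
      by_contra! h
      exact hij (hc.2 _ _ h))
  have hL : ∀ i, L i i = 1 := by
    intro i
    have h6 := congrFun (congrFun h5 i) i
    rw [Matrix.mul_apply, Finset.sum_eq_single i] at h6
    · simpa [hc.1, h1.1] using h6.symm
    · intro j _ hj
      by_contra h
      exact hj (u.injective (le_antisymm (h2 _ _ (right_ne_zero_of_mul h))
        (h4 _ _ (left_ne_zero_of_mul h))))
    · simp
  refine ⟨mem_Ngrp_iff.2 ⟨h1, _, upperUni_submatrix_symm h1.1 h2, by simp⟩, L,
    mem_Nminus_iff.2 ⟨⟨hL, h3⟩, _, upperUni_submatrix_symm hL h4, by simp⟩, h5⟩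

/-! ### The point of `y N(u)` obtained from `x N_-(u)` -/

/-- The factor `[x n]_+`, for the unique `n ∈ N_-(u)` such that it lies in `y N(u)`. -/
noncomputable def twist {n : ℕ} (u : Equiv.Perm (Fin n)) (x y : Mat n) : Mat n :=
  y * (elimUpper (((elimUpper (x.submatrix id u.symm))⁻¹ *
    elimUpper (y.submatrix id u.symm)).submatrix u u))⁻¹

theorem eq_mul_submatrix {n : ℕ} {u : Equiv.Perm (Fin n)} {x L b : Mat n}
    (h : x.submatrix id u.symm = L * b) : x = L.submatrix id u * b.submatrix u u := by
  rw [Matrix.submatrix_mul_equiv, ← h, Matrix.submatrix_submatrix]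
  simp

theorem twist_spec {n : ℕ} {u : Equiv.Perm (Fin n)} {x y : Mat n}
    (hx : LeadNZ (x.submatrix id u.symm)) (hy : LeadNZ (y.submatrix id u.symm)) :
    (∃ m ∈ Ngrp u, twist u x y = y * m) ∧
      ∃ m ∈ Nminus u, ∃ K, lowerTriInv K ∧ x * m = K * twist u x y := by
  obtain ⟨Lx, hLx, ex⟩ := hx.exists_lowerTriInv
  obtain ⟨Ly, hLy, ey⟩ := hy.exists_lowerTriInv
  have hbx := hx.upperUni_elimUpper
  have hby := hy.upperUni_elimUpper
  obtain ⟨hr, m, hm, e⟩ := factor_mem_of_conj (hbx.inv.mul hby) u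
  refine ⟨⟨_, inv_mem_Ngrp hr, rfl⟩, m, hm, Lx * Ly⁻¹, hLx.mul hLy.inv, ?_⟩
  unfold twist
  generalize elimUpper (y.submatrix id u.symm) = c at *
  generalize elimUpper (x.submatrix id u.symm) = bx at *
  generalize elimUpper ((bx⁻¹ * c).submatrix u u) = r at *
  have hru := (mem_Ngrp_iff.1 hr).1
  have hm' : m = (bx⁻¹ * c).submatrix u u * r⁻¹ := by
    rw [e, Matrix.mul_nonsing_inv_cancel_right _ _ hru.isUnit_det]
  calc x * m = Lx.submatrix id u * c.submatrix u u * r⁻¹ := by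
        rw [hm', eq_mul_submatrix ex, ← Matrix.mul_assoc, Matrix.mul_assoc (Lx.submatrix id u),
          Matrix.submatrix_mul_equiv, Matrix.mul_nonsing_inv_cancel_left _ _ hbx.isUnit_det]
    _ = Lx * Ly⁻¹ * (y * r⁻¹) := by
        rw [← Matrix.mul_assoc]
        congr 1
        rw [eq_mul_submatrix ey, Matrix.submatrix_mul_equiv, Matrix.submatrix_mul_equiv]
        change _ = (Lx * Ly⁻¹ * (Ly * c)).submatrix id u
        rw [Matrix.mul_assoc Lx, Matrix.nonsing_inv_mul_cancel_left _ _ hLy.1]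

theorem Nminus_factor_unique {n : ℕ} {u : Equiv.Perm (Fin n)} {x y : Mat n}
    (hx : LeadNZ (x.submatrix id u.symm)) (hy : LeadNZ (y.submatrix id u.symm))
    {m m' p p' K K' : Mat n} (hm : m ∈ Nminus u) (hm' : m' ∈ Nminus u) (hp : p ∈ Ngrp u)
    (hp' : p' ∈ Ngrp u) (hK : lowerTriInv K) (hK' : lowerTriInv K')
    (h : x * m = K * (y * p)) (h' : x * m' = K' * (y * p')) : m = m' := by
  obtain ⟨Lx, hLx, ex⟩ := hx.exists_lowerTriInv
  obtain ⟨Ly, hLy, ey⟩ := hy.exists_lowerTriInv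
  have hbx := hx.upperUni_elimUpper
  have hby := hy.upperUni_elimUpper
  generalize elimUpper (y.submatrix id u.symm) = c at *
  generalize elimUpper (x.submatrix id u.symm) = bx at *
  have key : ∀ {m p K : Mat n}, m ∈ Nminus u → p ∈ Ngrp u → lowerTriInv K →
      x * m = K * (y * p) → m * p⁻¹ = (bx⁻¹ * c).submatrix u u := by
    intro m p K hm hp hK h
    obtain ⟨-, M, hM, rfl⟩ := mem_Nminus_iff.1 hm
    obtain ⟨-, P, hP, rfl⟩ := mem_Ngrp_iff.1 hp
    have h1 : ∀ z W : Mat n, (z * W.submatrix u u).submatrix id u.symm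
        = z.submatrix id u.symm * W := by
      intro z W
      rw [← Matrix.submatrix_mul_equiv z (W.submatrix u u) id u.symm u.symm]
      simp
    have h2 : (Lx * bx) * M = K * ((Ly * c) * P) := by
      rw [← ex, ← ey, ← h1, ← h1, h]
      rfl
    have h3 : bx * M = c * P := by
      refine upper_factor_unique hLx (hK.mul hLy) (hbx.mul hM) (hby.mul hP) ?_
      simpa only [Matrix.mul_assoc] using h2
    rw [Matrix.inv_submatrix_equiv, Matrix.submatrix_mul_equiv]
    congr 1
    rw [← Matrix.nonsing_inv_mul_cancel_left bx M hbx.isUnit_det, h3, Matrix.mul_assoc,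
      Matrix.mul_assoc, Matrix.mul_nonsing_inv _ hP.isUnit_det, Matrix.mul_one]
  have e : m * p⁻¹ = m' * p'⁻¹ := (key hm hp hK h).trans (key hm' hp' hK' h').symm
  have hu := (mem_Ngrp_iff.1 (inv_mem_Ngrp hp)).1
  have e' : p⁻¹ = p'⁻¹ := upper_factor_unique (mem_Nminus_iff.1 hm).1.lowerTriInv
    (mem_Nminus_iff.1 hm').1.lowerTriInv hu (mem_Ngrp_iff.1 (inv_mem_Ngrp hp')).1 e
  rw [← e'] at e
  calc m = m * p⁻¹ * p⁻¹⁻¹ := (Matrix.mul_nonsing_inv_cancel_right _ _ hu.isUnit_det).symm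
    _ = m' := by rw [e, Matrix.mul_nonsing_inv_cancel_right _ _ hu.isUnit_det]

/-! ### Continuity and total nonnegativity -/

theorem isClosed_isTN {n : ℕ} : IsClosed {A : Mat n | IsTN A} := by
  simp only [IsTN, Set.ofPred_forall]
  exact isClosed_iInter fun k => isClosed_iInter fun f => isClosed_iInter fun g =>
    isClosed_iInter fun _ => isClosed_iInter fun _ =>
      isClosed_le continuous_const (continuous_id.matrix_submatrix f g).matrix_det

theorem isOpen_isUpperTP {n : ℕ} : IsOpen {A : Mat n | IsUpperTP A} := by
  have : {A : Mat n | IsUpperTP A} = ⋂ (k : Fin (n + 1)) (f : Fin k → Fin n) (g : Fin k → Fin n)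
      (_ : StrictMono f) (_ : StrictMono g) (_ : ∀ i, f i ≤ g i),
      {A : Mat n | 0 < (A.submatrix f g).det} := by
    ext A
    simp only [Set.mem_iInter, Set.mem_ofPred_eq]
    refine ⟨fun h k f g hf hg hfg => h k f g hf hg hfg, fun h k f g hf hg hfg => ?_⟩
    have hk : k ≤ n := by simpa using Fintype.card_le_of_injective f hf.injective
    exact h ⟨k, by omega⟩ f g hf hg hfg
  rw [this]
  exact isOpen_iInter_of_finite fun k => isOpen_iInter_of_finite fun f =>
    isOpen_iInter_of_finite fun g => isOpen_iInter_of_finite fun _ =>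
    isOpen_iInter_of_finite fun _ => isOpen_iInter_of_finite fun _ =>
      isOpen_lt continuous_const (continuous_id.matrix_submatrix f g).matrix_det

theorem IsUpperTP.leadNZ_submatrix {n : ℕ} {x : Mat n} (hx : IsUpperTP x)
    (w : Equiv.Perm (Fin n)) : LeadNZ (x.submatrix id w) := by
  intro k f hf
  have hfm : StrictMono f := fun a b h => Fin.lt_def.2 (by rw [hf, hf]; exact h)
  obtain ⟨σ, hσ⟩ := exists_perm_strictMono (w.injective.comp hfm.injective)
  have h1 : ∀ i, f i ≤ ((w ∘ f) ∘ σ) i := by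
    intro i
    rw [Fin.le_def, hf]
    obtain ⟨i, hi⟩ := i
    induction i with
    | zero => exact Nat.zero_le _
    | succ i ih =>
      have h2 := ih (by omega)
      have h3 := Fin.lt_def.1 (hσ (show (⟨i, by omega⟩ : Fin k) < ⟨i + 1, hi⟩ by simp))
      simp only at h2 ⊢
      omega
  have h2 := (hx k f _ hfm hσ h1).ne'
  rw [show x.submatrix f ((w ∘ f) ∘ σ) = ((x.submatrix id w).submatrix f f).submatrix id σ from rfl,
    Matrix.det_permute'] at h2
  exact right_ne_zero_of_mul h2

theorem upperUni_twist {n : ℕ} {u : Equiv.Perm (Fin n)} {x y : Mat n} (hyu : upperUni y)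
    (hx : LeadNZ (x.submatrix id u.symm)) (hy : LeadNZ (y.submatrix id u.symm)) :
    upperUni (twist u x y) := by
  obtain ⟨⟨m, hm, e⟩, -⟩ := twist_spec hx hy
  rw [e]
  exact hyu.mul (mem_Ngrp_iff.1 hm).1

theorem twist_self {n : ℕ} {u : Equiv.Perm (Fin n)} {x : Mat n}
    (hx : LeadNZ (x.submatrix id u.symm)) : twist u x x = x := by
  have h : elimUpper (1 : Mat n) = 1 := by
    have := elimUpper_mul (n := n) (L := 1) (b := 1)
      (lowerUni.lowerTriInv (lowerUni_iff_transpose.2 (by simpa using upperUni_one n)))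
      (upperUni_one n)
    rwa [mul_one] at this
  rw [twist, Matrix.nonsing_inv_mul _ hx.upperUni_elimUpper.isUnit_det,
    Matrix.submatrix_one_equiv, h, inv_one, mul_one]

theorem continuousAt_twist {n : ℕ} {u : Equiv.Perm (Fin n)} {x y : ℝ → Mat n} {t : ℝ}
    (hxc : ContinuousAt x t) (hyc : ContinuousAt y t)
    (hx : LeadNZ ((x t).submatrix id u.symm)) (hy : LeadNZ ((y t).submatrix id u.symm)) :
    ContinuousAt (fun s => twist u (x s) (y s)) t := by
  have hsub : ∀ (v w : Fin n → Fin n) (z : ℝ → Mat n), ContinuousAt z t →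
      ContinuousAt (fun s => (z s).submatrix v w) t := fun v w z hz =>
    (continuous_id.matrix_submatrix v w).continuousAt.comp hz
  have hmul : ∀ z w : ℝ → Mat n, ContinuousAt z t → ContinuousAt w t →
      ContinuousAt (fun s => z s * w s) t := fun z w hz hw => hz.mul hw
  have hup : ∀ z : ℝ → Mat n, ContinuousAt z t → LeadNZ (z t) →
      ContinuousAt (fun s => elimUpper (z s)) t := fun z hz h =>
    ContinuousAt.comp (f := z) h.continuousAt_elimUpper hz
  have hinv : ∀ z : ℝ → Mat n, ContinuousAt z t → upperUni (z t) →
      ContinuousAt (fun s => (z s)⁻¹) t := fun z hz h =>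
    ContinuousAt.comp (f := z) h.continuousAt_inv hz
  have hc := (hx.upperUni_elimUpper.inv.mul hy.upperUni_elimUpper).leadNZ_submatrix u
  exact hmul _ _ hyc (hinv _ (hup _ (hsub _ _ _ (hmul _ _
    (hinv _ (hup _ (hsub _ _ _ hxc) hx) hx.upperUni_elimUpper) (hup _ (hsub _ _ _ hyc) hy))) hc)
    hc.upperUni_elimUpper)

theorem IsUpperTP.isUpperTP_twist {n : ℕ} {u : Equiv.Perm (Fin n)} {x y : Mat n}
    (hx : IsUpperTP x) (hy : IsUpperTP y) (h : IsTN (twist u x y)) : IsUpperTP (twist u x y) := by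
  obtain ⟨-, m, hm, K, hK, e⟩ := twist_spec (hx.leadNZ_submatrix u.symm) (hy.leadNZ_submatrix u.symm)
  have hml := (mem_Nminus_iff.1 hm).1.lowerTriInv
  refine h.isUpperTP fun k f g hf hg => ?_
  have e' : twist u x y = K⁻¹ * (x * m) := by
    rw [e, Matrix.nonsing_inv_mul_cancel_left _ _ hK.1]
  have hfm : StrictMono f := fun a b h => Fin.lt_def.2 (by rw [hf, hf]; exact h)
  have hgm : StrictMono g := fun a b h => Fin.lt_def.2 (by
    have h1 := hg a
    have h2 := hg b
    have h3 := Fin.lt_def.1 h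
    omega)
  have hfg : ∀ i, f i ≤ g i := fun i => Fin.le_def.2 (by
    have h1 := hf i
    have h2 := hg i
    have h3 : k ≤ n := by simpa using Fintype.card_le_of_injective f hfm.injective
    omega)
  rw [e', lower_mul_submatrix hK.inv.2 _ hf, mul_lower_submatrix _ hml.2 _ hg, Matrix.det_mul,
    Matrix.det_mul]
  exact mul_ne_zero (det_submatrix_self_ne_zero_of_lower hK.inv hfm.injective)
    (mul_ne_zero (hx k f g hfm hgm hfg).ne' (det_submatrix_self_ne_zero_of_lower hml hgm.injective))

/-- Conjugation of an upper triangular matrix by powers of `t ^ 2`, extended by `t = 0`. -/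
def scaleUpper {n : ℕ} (t : ℝ) (x : Mat n) : Mat n :=
  Matrix.of fun i j => (t ^ 2) ^ ((j : ℕ) - (i : ℕ)) * x i j

theorem upperUni.scaleUpper {n : ℕ} {x : Mat n} (hx : upperUni x) (t : ℝ) :
    upperUni (scaleUpper t x) :=
  ⟨fun i => by simp [BruhatTNN.scaleUpper, hx.1],
    fun i j h => by simp [BruhatTNN.scaleUpper, hx.2 i j h]⟩

theorem scaleUpper_zero {n : ℕ} {x : Mat n} (hx : upperUni x) : scaleUpper 0 x = 1 := by
  ext i j
  rcases lt_trichotomy i j with h | rfl | h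
  · have : (j : ℕ) - (i : ℕ) ≠ 0 := by have := Fin.lt_def.1 h; omega
    simp [scaleUpper, Matrix.one_apply_ne h.ne, this]
  · simp [scaleUpper, hx.1]
  · simp [scaleUpper, hx.2 i j h, Matrix.one_apply_ne h.ne']

theorem scaleUpper_one {n : ℕ} (x : Mat n) : scaleUpper 1 x = x := by
  ext i j
  simp [scaleUpper]

theorem continuous_scaleUpper {n : ℕ} (x : Mat n) : Continuous fun t => scaleUpper t x :=
  continuous_matrix fun i j => by simp only [scaleUpper, Matrix.of_apply]; fun_prop

theorem IsTN.scaleUpper {n : ℕ} {x : Mat n} (hx : IsTN x) (hxu : upperUni x) (t : ℝ) :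
    IsTN (scaleUpper t x) := by
  rcases eq_or_ne t 0 with rfl | ht
  · rw [scaleUpper_zero hxu]
    exact isTN_one n
  have hs : 0 < t ^ 2 := by positivity
  intro k f g hf hg
  have : (BruhatTNN.scaleUpper t x).submatrix f g = Matrix.of fun i j =>
      ((t ^ 2) ^ (f i : ℕ))⁻¹ * (Matrix.of fun i j => (t ^ 2) ^ (g j : ℕ) *
        x.submatrix f g i j) i j := by
    ext i j
    simp only [BruhatTNN.scaleUpper, Matrix.submatrix_apply, Matrix.of_apply]
    rcases lt_or_ge (g j) (f i) with h | h
    · simp [hxu.2 _ _ h]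
    · rw [pow_sub₀ _ hs.ne' (Fin.le_def.1 h)]
      ring
  rw [this, Matrix.det_mul_column, Matrix.det_mul_row]
  exact mul_nonneg (Finset.prod_nonneg fun i _ => by positivity)
    (mul_nonneg (Finset.prod_nonneg fun i _ => by positivity) (hx k f g hf hg))

theorem isTN_twist_mul {n : ℕ} (u : Equiv.Perm (Fin n)) {x y T : Mat n} (hx : IsTN x)
    (hxu : upperUni x) (hy : IsTN y) (hyu : upperUni y) (hT : IsUpperTP T) (hTu : upperUni T) :
    IsTN (twist u (x * T) (y * T)) := by
  have hX : ∀ {z : Mat n}, IsTN z → upperUni z → ∀ t, IsUpperTP (scaleUpper t z * T) :=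
    fun hz hzu t => (hz.scaleUpper hzu t).mul_isUpperTP (hzu.scaleUpper t) hT hTu
  let F : ℝ → Mat n := fun t => twist u (scaleUpper t x * T) (scaleUpper t y * T)
  have hF : Continuous F := continuous_iff_continuousAt.2 fun t =>
    continuousAt_twist ((continuous_scaleUpper x).mul continuous_const).continuousAt
      ((continuous_scaleUpper y).mul continuous_const).continuousAt
      ((hX hx hxu t).leadNZ_submatrix _) ((hX hy hyu t).leadNZ_submatrix _)
  have hset : F ⁻¹' {A | IsTN A} = F ⁻¹' {A | IsUpperTP A} := by
    ext t
    exact ⟨fun h => (hX hx hxu t).isUpperTP_twist (hX hy hyu t) h, fun h => IsUpperTP.isTN h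
      (upperUni_twist ((hyu.scaleUpper t).mul hTu) ((hX hx hxu t).leadNZ_submatrix _)
        ((hX hy hyu t).leadNZ_submatrix _))⟩
  have hclopen : IsClopen (F ⁻¹' {A | IsTN A}) :=
    ⟨isClosed_isTN.preimage hF, hset ▸ isOpen_isUpperTP.preimage hF⟩
  have h0 : F 0 = T := by
    simp only [F, scaleUpper_zero hxu, scaleUpper_zero hyu, one_mul]
    exact twist_self (hT.leadNZ_submatrix _)
  have h1 : (1 : ℝ) ∈ F ⁻¹' {A | IsTN A} := by
    rw [hclopen.eq_univ ⟨0, show IsTN (F 0) from h0 ▸ hT.isTN hTu⟩]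
    trivial
  have h2 : IsTN (F 1) := h1
  simpa only [F, scaleUpper_one] using h2

theorem isTN_twist {n : ℕ} {u : Equiv.Perm (Fin n)} {x y : Mat n} (hx : IsTN x)
    (hxu : upperUni x) (hy : IsTN y) (hyu : upperUni y)
    (hx0 : LeadNZ (x.submatrix id u.symm)) (hy0 : LeadNZ (y.submatrix id u.symm)) :
    IsTN (twist u x y) := by
  have hT : Continuous fun ε : ℝ => bidiag n ε ^ n := by
    refine Continuous.pow (continuous_matrix fun i j => ?_) n
    simp only [bidiag, Matrix.of_apply]
    split_ifs <;> fun_prop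
  have hc := continuousAt_twist (u := u) (t := 0) (x := fun ε => x * bidiag n ε ^ n)
    (y := fun ε => y * bidiag n ε ^ n) (continuous_const.mul hT).continuousAt
    (continuous_const.mul hT).continuousAt (by simpa [bidiag_zero] using hx0)
    (by simpa [bidiag_zero] using hy0)
  have h1 : Filter.Tendsto (fun ε => twist u (x * bidiag n ε ^ n) (y * bidiag n ε ^ n))
      (nhdsWithin 0 (Set.Ioi 0)) (nhds (twist u x y)) := by
    have := hc.tendsto
    simp only [bidiag_zero, one_pow, mul_one] at this
    exact this.mono_left nhdsWithin_le_nhds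
  refine isClosed_isTN.mem_of_tendsto h1 ?_
  filter_upwards [self_mem_nhdsWithin] with ε hε
  exact isTN_twist_mul u hx hxu hy hyu (isUpperTP_bidiag_pow n hε) ((upperUni_bidiag n ε).pow n)

theorem statement12 (n : ℕ) (hn : 1 ≤ n) (u : Equiv.Perm (Fin n)) (tx : Mat n)
    (htx : upperUni tx) (hg : hasGauss (tx * permMat u⁻¹))
    (xu : Mat n) (hxu : xu ∈ Ncell u) :
    ∃ nm ∈ Nminus u,
      hasGauss (tx * nm) ∧
      (∃ m ∈ Ngrp u, gaussPlus (tx * nm) = xu * m) ∧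
      (∀ nm' ∈ Nminus u, hasGauss (tx * nm') →
        (∃ m ∈ Ngrp u, gaussPlus (tx * nm') = xu * m) → nm' = nm) ∧
      (totNonneg tx → totNonneg xu → totNonneg (gaussPlus (tx * nm))) := by
  have hx : LeadNZ (tx.submatrix id u.symm) := by
    have := hg.leadNZ
    rwa [mul_permMat] at this
  have hy := leadNZ_of_mem_Ncell hxu
  obtain ⟨⟨m, hm, e⟩, nm, hnm, K, hK, e'⟩ := twist_spec hx hy
  have hz := upperUni_twist hxu.1 hx hy
  have hgp : gaussPlus (tx * nm) = twist u tx xu := by rw [e', gaussPlus_mul hK hz]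
  refine ⟨nm, hnm, hasGauss_of_eq_mul hK hz e', ⟨m, hm, hgp.trans e⟩, ?_, fun h1 h2 => ?_⟩
  · rintro nm' hnm' hg' ⟨m', hm', e''⟩
    obtain ⟨K', hK', -, h⟩ := hg'.exists_eq_mul
    rw [e''] at h
    rw [e] at e'
    exact Nminus_factor_unique hx hy hnm' hnm hm' hm hK' hK h e'
  · rw [hgp, totNonneg_iff_isTN]
    exact isTN_twist (totNonneg_iff_isTN.1 h1) htx (totNonneg_iff_isTN.1 h2) hxu.1 hx hy

end BruhatTNN
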